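/- arXiv:2212.03549 — 4 statements merged into one kernel-verified Lean document; each statement's English description precedes it below -/
import Mathlib

section
/- Let 0 < r_e < r_s, let d satisfy r_s − r_e ≤ d ≤ √(r_s² − r_e²), and set ξ = arccos((r_s² + r_e² − d²)/(2 r_e r_s)). Let φ ∈ (0, π) satisfy |π/2 − φ| < ξ. Then the Lebesgue measure of the set of orbital angles {ω ∈ [0, 2π) : r_s² − 2 r_s r_e sin ω sin φ + r_e² ≤ d²} equals 2·arcsin(√(1 − cos²ξ / sin²φ)). Consequently the arc length of the intersection of the orbit of inclination φ with the spherical cap C_d is 2 r_s · arcsin(√(1 − cos²ξ · csc²φ)). -/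
open MeasureTheory Real

/-- The Lebesgue measure of the set of orbital angles of an orbit of inclination `φ` whose
satellite position lies in the spherical cap `C_d` is `2 arcsin(√(1 - cos²ξ/sin²φ))`;
consequently the arc length of the intersection of the orbit with `C_d` is
`2 r_s arcsin(√(1 - cos²ξ csc²φ))`. -/
theorem measure_orbitalAngles_in_cap (r_e r_s d ξ φ : ℝ)
    (hre : 0 < r_e) (hrs : r_e < r_s)
    (hd₁ : r_s - r_e ≤ d) (hd₂ : d ≤ Real.sqrt (r_s ^ 2 - r_e ^ 2))
    (hξ : ξ = Real.arccos ((r_s ^ 2 + r_e ^ 2 - d ^ 2) / (2 * r_e * r_s)))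
    (hφ : φ ∈ Set.Ioo (0 : ℝ) π) (hφξ : |π / 2 - φ| < ξ) :
    volume {ω ∈ Set.Ico (0 : ℝ) (2 * π) |
        r_s ^ 2 - 2 * r_s * r_e * Real.sin ω * Real.sin φ + r_e ^ 2 ≤ d ^ 2} =
      ENNReal.ofReal (2 * Real.arcsin (Real.sqrt (1 - Real.cos ξ ^ 2 / Real.sin φ ^ 2))) ∧
    r_s * (volume {ω ∈ Set.Ico (0 : ℝ) (2 * π) |
        r_s ^ 2 - 2 * r_s * r_e * Real.sin ω * Real.sin φ + r_e ^ 2 ≤ d ^ 2}).toReal =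
      2 * r_s * Real.arcsin (Real.sqrt (1 - Real.cos ξ ^ 2 * (1 / Real.sin φ) ^ 2)) := by
  have hrs0 : 0 < r_s := hre.trans hrs
  have hd0 : 0 ≤ d := by linarith
  have hd2 : d ^ 2 ≤ r_s ^ 2 - r_e ^ 2 := by
    have h : 0 ≤ r_s ^ 2 - r_e ^ 2 := by nlinarith
    calc d ^ 2 ≤ (Real.sqrt (r_s ^ 2 - r_e ^ 2)) ^ 2 := by gcongr
      _ = _ := Real.sq_sqrt h
  have hd3 : (r_s - r_e) ^ 2 ≤ d ^ 2 := by
    have : 0 ≤ r_s - r_e := by linarith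
    gcongr
  have hden : 0 < 2 * r_e * r_s := by positivity
  have hc0 : 0 < (r_s ^ 2 + r_e ^ 2 - d ^ 2) / (2 * r_e * r_s) := by
    apply div_pos _ hden
    nlinarith
  have hc1 : (r_s ^ 2 + r_e ^ 2 - d ^ 2) / (2 * r_e * r_s) ≤ 1 := by
    rw [div_le_one hden]; nlinarith
  have hcos : Real.cos ξ = (r_s ^ 2 + r_e ^ 2 - d ^ 2) / (2 * r_e * r_s) := by
    rw [hξ, Real.cos_arccos (by linarith) hc1]
  have hs : 0 < Real.sin φ := Real.sin_pos_of_mem_Ioo hφ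
  have hlt : Real.cos ξ < Real.sin φ := by
    rw [← Real.cos_pi_div_two_sub, ← Real.cos_abs (π / 2 - φ)]
    exact Real.cos_lt_cos_of_nonneg_of_le_pi (abs_nonneg _) (hξ ▸ Real.arccos_le_pi _) hφξ
  have hceq : Real.cos ξ * (2 * r_e * r_s) = r_s ^ 2 + r_e ^ 2 - d ^ 2 := by
    rw [hcos]; field_simp
  rw [← hcos] at hc0 hc1
  obtain ⟨t, ht⟩ : ∃ t, t = Real.cos ξ / Real.sin φ := ⟨_, rfl⟩
  have ht0 : 0 < t := ht ▸ div_pos hc0 hs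
  have ht1 : t < 1 := by rw [ht, div_lt_one hs]; exact hlt
  have hset : {ω ∈ Set.Ico (0 : ℝ) (2 * π) |
        r_s ^ 2 - 2 * r_s * r_e * Real.sin ω * Real.sin φ + r_e ^ 2 ≤ d ^ 2} =
      Set.Icc (Real.arcsin t) (π - Real.arcsin t) := by
    have ha0 : 0 < Real.arcsin t := Real.arcsin_pos.2 ht0
    have hpi := Real.pi_pos
    ext ω
    have hiff : r_s ^ 2 - 2 * r_s * r_e * Real.sin ω * Real.sin φ + r_e ^ 2 ≤ d ^ 2 ↔
        t ≤ Real.sin ω := by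
      rw [ht, div_le_iff₀ hs, ← mul_le_mul_iff_left₀ (b := Real.cos ξ) hden, hceq]
      constructor <;> intro h <;> linarith
    simp only [Set.mem_ofPred_eq, Set.mem_Ico, Set.mem_Icc, hiff]
    constructor
    · rintro ⟨⟨h0, h1⟩, h⟩
      have hωπ : ω < π := by
        by_contra hc
        have := Real.sin_nonneg_of_nonneg_of_le_pi (x := ω - π) (by linarith) (by linarith)
        rw [Real.sin_sub_pi] at this
        linarith
      have hle := Real.arcsin_le_pi_div_two t
      constructor
      · by_cases hw : ω ≤ π / 2
        · exact (Real.arcsin_le_iff_le_sin ⟨by linarith, by linarith⟩ ⟨by linarith, hw⟩).2 h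
        · linarith
      · by_cases hw : ω ≤ π / 2
        · linarith
        · have := (Real.arcsin_le_iff_le_sin (x := t) (y := π - ω) ⟨by linarith, by linarith⟩
            ⟨by linarith, by linarith⟩).2 (by rwa [Real.sin_pi_sub])
          linarith
    · rintro ⟨h0, h1⟩
      refine ⟨⟨by linarith, by linarith⟩, ?_⟩
      by_cases hw : ω ≤ π / 2
      · exact (Real.arcsin_le_iff_le_sin ⟨by linarith, by linarith⟩ ⟨by linarith, hw⟩).1 h0
      · rw [← Real.sin_pi_sub]
        exact (Real.arcsin_le_iff_le_sin (x := t) (y := π - ω) ⟨by linarith, by linarith⟩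
            ⟨by linarith, by linarith⟩).1 (by linarith)
  have hval : π - Real.arcsin t - Real.arcsin t =
      2 * Real.arcsin (Real.sqrt (1 - Real.cos ξ ^ 2 / Real.sin φ ^ 2)) := by
    rw [← div_pow, ← ht, ← Real.arccos_eq_arcsin ht0.le, Real.arccos]
    ring
  have hvol := Real.volume_Icc (a := Real.arcsin t) (b := π - Real.arcsin t)
  rw [hval] at hvol
  rw [hset, hvol]
  refine ⟨rfl, ?_⟩
  have hn : 0 ≤ Real.arcsin (Real.sqrt (1 - Real.cos ξ ^ 2 / Real.sin φ ^ 2)) :=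
    Real.arcsin_nonneg.2 (Real.sqrt_nonneg _)
  rw [ENNReal.toReal_ofReal (by linarith), one_div, inv_pow, ← div_eq_mul_inv]
  ring
end

section
/- Let 0 < r_e < r_s, let d satisfy r_s − r_e ≤ d ≤ √(r_s² − r_e²), and set ξ = arccos((r_s² + r_e² − d²)/(2 r_e r_s)). For every inclination φ ∈ (0, π), the set {ω ∈ [0, 2π) : r_s² − 2 r_s r_e sin ω sin φ + r_e² ≤ d²} is nonempty if and only if |π/2 − φ| ≤ ξ; that is, the orbit of inclination φ meets the spherical cap C_d if and only if its inclination satisfies |π/2 − φ| ≤ ξ(d). -/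
open MeasureTheory Real

/-- An orbit of inclination `φ` meets the spherical cap `C_d` (i.e. some orbital angle gives a
satellite position within distance `d` of the user) iff `|π/2 - φ| ≤ ξ(d)`. -/
theorem orbit_meets_cap_iff (r_e r_s d ξ φ : ℝ)
    (hre : 0 < r_e) (hrs : r_e < r_s)
    (hd₁ : r_s - r_e ≤ d) (hd₂ : d ≤ Real.sqrt (r_s ^ 2 - r_e ^ 2))
    (hξ : ξ = Real.arccos ((r_s ^ 2 + r_e ^ 2 - d ^ 2) / (2 * r_e * r_s)))
    (hφ : φ ∈ Set.Ioo (0 : ℝ) π) :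
    {ω ∈ Set.Ico (0 : ℝ) (2 * π) |
        r_s ^ 2 - 2 * r_s * r_e * Real.sin ω * Real.sin φ + r_e ^ 2 ≤ d ^ 2}.Nonempty ↔
      |π / 2 - φ| ≤ ξ := by
  obtain ⟨h0, h1⟩ := hφ
  have hrs0 : 0 < r_s := hre.trans hrs
  have hp : 0 < 2 * r_e * r_s := by positivity
  have hd0 : 0 < d := by linarith
  have hdsq : d ^ 2 ≤ r_s ^ 2 - r_e ^ 2 := by
    have := Real.sq_sqrt (show 0 ≤ r_s ^ 2 - r_e ^ 2 by nlinarith)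
    rw [← this]
    exact pow_le_pow_left₀ hd0.le hd₂ 2
  set c := (r_s ^ 2 + r_e ^ 2 - d ^ 2) / (2 * r_e * r_s) with hc
  have hcm : c * (2 * r_e * r_s) = r_s ^ 2 + r_e ^ 2 - d ^ 2 := by
    rw [hc]; field_simp
  have hc0 : 0 ≤ c := by
    rw [hc]; apply div_nonneg _ hp.le; nlinarith
  have hc1 : c ≤ 1 := by
    rw [hc, div_le_one hp]; nlinarith
  have hsin : 0 < Real.sin φ := Real.sin_pos_of_pos_of_lt_pi h0 h1
  have habs : |π / 2 - φ| = Real.arccos (Real.sin φ) := by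
    rw [← Real.cos_pi_div_two_sub, ← Real.cos_abs, Real.arccos_cos (abs_nonneg _)]
    rw [abs_le]; constructor <;> linarith
  have key : |π / 2 - φ| ≤ ξ ↔ c ≤ Real.sin φ := by
    rw [habs, hξ]
    exact Real.strictAntiOn_arccos.le_iff_ge ⟨by linarith, Real.sin_le_one φ⟩
      ⟨by linarith, hc1⟩
  rw [key]
  constructor
  · rintro ⟨ω, -, hω⟩
    have h2 : Real.sin ω * Real.sin φ ≤ Real.sin φ := by
      nlinarith [Real.sin_le_one ω]
    have h3 : c * (2 * r_e * r_s) ≤ (Real.sin ω * Real.sin φ) * (2 * r_e * r_s) := by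
      rw [hcm]; linarith
    exact (le_of_mul_le_mul_right h3 hp).trans h2
  · intro h
    refine ⟨π / 2, ⟨by positivity, by linarith [Real.pi_pos]⟩, ?_⟩
    have := mul_le_mul_of_nonneg_right h hp.le
    rw [hcm] at this
    rw [Real.sin_pi_div_two]
    linarith
end

section
/- Let λ > 0 and φ̄ ∈ (0, π/2). Then, as μ → ∞, the no-satellite probability expression exp(−λ ∫₀^{φ̄} cos φ · (1 − exp(−(μ/π)·arcsin(√(1 − cos²φ̄ / cos²φ)))) dφ) converges to exp(−λ sin φ̄). That is, when the mean number μ of satellites per orbit tends to infinity, the no-satellite probability is asymptotically exp(−λ sin φ̄), where φ̄ = arccos(r_e/r_s). -/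
open MeasureTheory Real Filter

/-- As the mean number `μ` of satellites per orbit tends to infinity, the no-satellite
probability `exp(-λ ∫₀^φ̄ cos φ (1 - e^{-(μ/π) arcsin √(1 - cos²φ̄ sec²φ)}) dφ)`
converges to `exp(-λ sin φ̄)`. -/
theorem noSatellite_prob_tendsto (lam phibar : ℝ) (hlam : 0 < lam)
    (hphibar : phibar ∈ Set.Ioo (0 : ℝ) (π / 2)) :
    Tendsto
      (fun μ : ℝ =>
        Real.exp (-(lam * ∫ φ in (0 : ℝ)..phibar,
          Real.cos φ *
            (1 - Real.exp (-(μ / π) *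
              Real.arcsin (Real.sqrt (1 - Real.cos phibar ^ 2 / Real.cos φ ^ 2)))))))
      atTop (nhds (Real.exp (-(lam * Real.sin phibar)))) := by
  obtain ⟨h0, h1⟩ := hphibar
  have key : Tendsto (fun μ : ℝ => ∫ φ in (0 : ℝ)..phibar,
      Real.cos φ * (1 - Real.exp (-(μ / π) *
        Real.arcsin (Real.sqrt (1 - Real.cos phibar ^ 2 / Real.cos φ ^ 2)))))
      atTop (nhds (∫ φ in (0 : ℝ)..phibar, Real.cos φ)) := by
    apply intervalIntegral.tendsto_integral_filter_of_dominated_convergence (fun _ => (1 : ℝ))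
    · refine Eventually.of_forall fun μ => ?_
      apply Measurable.aestronglyMeasurable
      have := Real.continuous_arcsin.measurable
      fun_prop
    · filter_upwards [eventually_ge_atTop (0 : ℝ)] with μ hμ
      refine Eventually.of_forall fun φ _ => ?_
      rw [norm_mul, Real.norm_eq_abs, Real.norm_eq_abs]
      have ha : 0 ≤ Real.arcsin (Real.sqrt (1 - Real.cos phibar ^ 2 / Real.cos φ ^ 2)) :=
        Real.arcsin_nonneg.2 (Real.sqrt_nonneg _)
      have hb : 0 ≤ μ / π := div_nonneg hμ Real.pi_pos.le
      have hc : Real.exp (-(μ / π) *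
          Real.arcsin (Real.sqrt (1 - Real.cos phibar ^ 2 / Real.cos φ ^ 2))) ≤ 1 := by
        rw [Real.exp_le_one_iff]
        nlinarith [mul_nonneg hb ha]
      have hd := Real.exp_pos (-(μ / π) *
          Real.arcsin (Real.sqrt (1 - Real.cos phibar ^ 2 / Real.cos φ ^ 2)))
      exact mul_le_one₀ (Real.abs_cos_le_one φ) (abs_nonneg _)
        (abs_le.2 ⟨by linarith, by linarith⟩)
    · exact intervalIntegrable_const
    · have hne : ∀ᵐ φ : ℝ ∂volume, φ ≠ phibar := by
        simp [ae_iff, measure_singleton]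
      filter_upwards [hne] with φ hφ hm
      rw [Set.uIoc_of_le h0.le] at hm
      have hlt : φ < phibar := lt_of_le_of_ne hm.2 hφ
      have hcb : 0 < Real.cos phibar := Real.cos_pos_of_mem_Ioo ⟨by linarith, h1⟩
      have hcc : Real.cos phibar < Real.cos φ :=
        Real.cos_lt_cos_of_nonneg_of_le_pi_div_two hm.1.le h1.le hlt
      have hpos : 0 < Real.arcsin (Real.sqrt (1 - Real.cos phibar ^ 2 / Real.cos φ ^ 2)) := by
        rw [Real.arcsin_pos, Real.sqrt_pos, sub_pos, div_lt_one (by nlinarith)]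
        nlinarith
      have h2 : Tendsto (fun μ : ℝ => -(μ / π) *
          Real.arcsin (Real.sqrt (1 - Real.cos phibar ^ 2 / Real.cos φ ^ 2))) atTop atBot :=
        (tendsto_neg_atTop_atBot.comp
          (tendsto_id.atTop_div_const Real.pi_pos)).atBot_mul_const hpos
      have h3 := ((Real.tendsto_exp_atBot.comp h2).const_sub 1).const_mul (Real.cos φ)
      simpa using h3
  rw [integral_cos, Real.sin_zero, sub_zero] at key
  exact (Real.continuous_exp.tendsto _).comp ((key.const_mul lam).neg)
end

section
/- Let 0 < r_e < r_s and let d₁, d₂ satisfy r_s − r_e ≤ d₁ < d₂ ≤ √(r_s² − r_e²). Set ξᵢ = arccos((r_s² + r_e² − dᵢ²)/(2 r_e r_s)) for i = 1, 2. Let φ ∈ (0, π) satisfy |π/2 − φ| < ξ₁. Then the Lebesgue measure of the set of orbital angles whose satellite location lies at distance in (d₁, d₂] from the user, {ω ∈ [0, 2π) : d₁² < r_s² − 2 r_s r_e sin ω sin φ + r_e² ≤ d₂²}, equals 2·(arcsin(√(1 − cos²ξ₂/sin²φ)) − arcsin(√(1 − cos²ξ₁/sin²φ))). -/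
open MeasureTheory Real

theorem aux_le_sin (a w : ℝ) (ha : 0 < a) (ha1 : a < 1) (h0 : 0 ≤ w) (h2 : w < 2 * π) :
    a ≤ Real.sin w ↔ Real.arcsin a ≤ w ∧ w ≤ π - Real.arcsin a := by
  have hp := Real.pi_pos
  have hA : 0 < Real.arcsin a := Real.arcsin_pos.2 ha
  have hA' : Real.arcsin a < π / 2 := Real.arcsin_lt_pi_div_two.2 ha1
  rcases le_total w (π / 2) with h | h
  · rw [← Real.arcsin_le_iff_le_sin ⟨by linarith, by linarith⟩ ⟨by linarith, by linarith⟩]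
    constructor
    · intro h'; exact ⟨h', by linarith⟩
    · exact fun h' => h'.1
  · rcases le_total w π with h3 | h3
    · rw [← Real.sin_pi_sub,
        ← Real.arcsin_le_iff_le_sin ⟨by linarith, by linarith⟩ ⟨by linarith, by linarith⟩]
      constructor
      · intro h'; exact ⟨by linarith, by linarith⟩
      · intro h'; linarith [h'.2]
    · have : Real.sin w ≤ 0 := by
        have := Real.sin_nonneg_of_nonneg_of_le_pi (x := w - π) (by linarith) (by linarith)
        rw [Real.sin_sub_pi] at this
        linarith
      constructor
      · intro h'; linarith
      · rintro ⟨_, h'⟩; linarith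



/-- The Lebesgue measure of the set of orbital angles on an orbit of inclination `φ` whose
satellite lies at distance in `(d₁, d₂]` from the user equals
`2 (arcsin √(1 - cos²ξ₂/sin²φ) - arcsin √(1 - cos²ξ₁/sin²φ))`. -/
theorem measure_orbitalAngles_annulus (r_e r_s d₁ d₂ ξ₁ ξ₂ φ : ℝ)
    (hre : 0 < r_e) (hrs : r_e < r_s)
    (hd₁ : r_s - r_e ≤ d₁) (hd₁₂ : d₁ < d₂) (hd₂ : d₂ ≤ Real.sqrt (r_s ^ 2 - r_e ^ 2))
    (hξ₁ : ξ₁ = Real.arccos ((r_s ^ 2 + r_e ^ 2 - d₁ ^ 2) / (2 * r_e * r_s)))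
    (hξ₂ : ξ₂ = Real.arccos ((r_s ^ 2 + r_e ^ 2 - d₂ ^ 2) / (2 * r_e * r_s)))
    (hφ : φ ∈ Set.Ioo (0 : ℝ) π) (hφξ : |π / 2 - φ| < ξ₁) :
    volume {ω ∈ Set.Ico (0 : ℝ) (2 * π) |
        d₁ ^ 2 < r_s ^ 2 - 2 * r_s * r_e * Real.sin ω * Real.sin φ + r_e ^ 2 ∧
        r_s ^ 2 - 2 * r_s * r_e * Real.sin ω * Real.sin φ + r_e ^ 2 ≤ d₂ ^ 2} =
      ENNReal.ofReal (2 *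
        (Real.arcsin (Real.sqrt (1 - Real.cos ξ₂ ^ 2 / Real.sin φ ^ 2)) -
         Real.arcsin (Real.sqrt (1 - Real.cos ξ₁ ^ 2 / Real.sin φ ^ 2)))) := by


  have hp := Real.pi_pos
  have hrs0 : 0 < r_s := hre.trans hrs
  have hD : 0 < 2 * r_e * r_s := by positivity
  have hd10 : 0 < d₁ := by linarith
  have hd2sq : d₂ ^ 2 ≤ r_s ^ 2 - r_e ^ 2 := by
    have h0 : 0 ≤ r_s ^ 2 - r_e ^ 2 := by nlinarith
    calc d₂ ^ 2 ≤ (Real.sqrt (r_s ^ 2 - r_e ^ 2)) ^ 2 :=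
          pow_le_pow_left₀ (by linarith) hd₂ 2
      _ = _ := Real.sq_sqrt h0
  have hd12sq : d₁ ^ 2 < d₂ ^ 2 := pow_lt_pow_left₀ hd₁₂ hd10.le (by norm_num)
  have hd1sq : (r_s - r_e) ^ 2 ≤ d₁ ^ 2 := pow_le_pow_left₀ (by linarith) hd₁ 2
  set c₁ := (r_s ^ 2 + r_e ^ 2 - d₁ ^ 2) / (2 * r_e * r_s) with hc₁
  set c₂ := (r_s ^ 2 + r_e ^ 2 - d₂ ^ 2) / (2 * r_e * r_s) with hc₂
  have e₁ : d₁ ^ 2 = r_s ^ 2 + r_e ^ 2 - (2 * r_e * r_s) * c₁ := by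
    rw [hc₁]; field_simp; ring
  have e₂ : d₂ ^ 2 = r_s ^ 2 + r_e ^ 2 - (2 * r_e * r_s) * c₂ := by
    rw [hc₂]; field_simp; ring
  have hc20 : 0 < c₂ := div_pos (by nlinarith) hD
  have hc12 : c₂ < c₁ := div_lt_div_of_pos_right (by linarith) hD
  have hc11 : c₁ ≤ 1 := by rw [hc₁, div_le_one hD]; nlinarith
  have k₁ : Real.cos ξ₁ = c₁ := by rw [hξ₁]; exact Real.cos_arccos (by linarith) hc11
  have k₂ : Real.cos ξ₂ = c₂ := by rw [hξ₂]; exact Real.cos_arccos (by linarith) (by linarith)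
  have hs0 : 0 < Real.sin φ := Real.sin_pos_of_pos_of_lt_pi hφ.1 hφ.2
  have hcs : c₁ < Real.sin φ := by
    rw [← k₁, ← Real.cos_pi_div_two_sub, ← Real.cos_abs (π / 2 - φ)]
    exact Real.cos_lt_cos_of_nonneg_of_le_pi (abs_nonneg _)
      (by rw [hξ₁]; exact Real.arccos_le_pi _) hφξ
  rw [k₁, k₂, ← div_pow, ← div_pow]
  have e₃ : c₁ = c₁ / Real.sin φ * Real.sin φ := by field_simp
  have e₄ : c₂ = c₂ / Real.sin φ * Real.sin φ := by field_simp
  have ha20 : 0 < c₂ / Real.sin φ := div_pos hc20 hs0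
  have ha12 : c₂ / Real.sin φ < c₁ / Real.sin φ := div_lt_div_of_pos_right hc12 hs0
  have ha11 : c₁ / Real.sin φ < 1 := (div_lt_one hs0).2 hcs
  generalize c₁ / Real.sin φ = a₁ at *
  generalize c₂ / Real.sin φ = a₂ at *
  rw [← Real.arccos_eq_arcsin ha20.le, ← Real.arccos_eq_arcsin (ha20.trans ha12).le,
    Real.arccos, Real.arccos]
  have hA2 : 0 < Real.arcsin a₂ := Real.arcsin_pos.2 ha20
  have hA12 : Real.arcsin a₂ < Real.arcsin a₁ :=
    Real.arcsin_lt_arcsin (by linarith) ha12 ha11.le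
  have hA1 : Real.arcsin a₁ < π / 2 := Real.arcsin_lt_pi_div_two.2 ha11
  have hE : 0 < 2 * r_e * r_s * Real.sin φ := mul_pos hD hs0
  have hset : {ω ∈ Set.Ico (0 : ℝ) (2 * π) |
        d₁ ^ 2 < r_s ^ 2 - 2 * r_s * r_e * Real.sin ω * Real.sin φ + r_e ^ 2 ∧
        r_s ^ 2 - 2 * r_s * r_e * Real.sin ω * Real.sin φ + r_e ^ 2 ≤ d₂ ^ 2} =
      Set.Ico (Real.arcsin a₂) (Real.arcsin a₁) ∪
        Set.Ioc (π - Real.arcsin a₁) (π - Real.arcsin a₂) := by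
    ext w
    have q₁ : d₁ ^ 2 < r_s ^ 2 - 2 * r_s * r_e * Real.sin w * Real.sin φ + r_e ^ 2 ↔
        ¬ a₁ ≤ Real.sin w := by
      rw [not_le, ← mul_lt_mul_iff_right₀ (b := Real.sin w) (c := a₁) hE, e₁, e₃]
      constructor <;> intro h <;> linarith
    have q₂ : r_s ^ 2 - 2 * r_s * r_e * Real.sin w * Real.sin φ + r_e ^ 2 ≤ d₂ ^ 2 ↔
        a₂ ≤ Real.sin w := by
      rw [← mul_le_mul_iff_right₀ (b := a₂) (c := Real.sin w) hE, e₂, e₄]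
      constructor <;> intro h <;> linarith
    simp only [Set.mem_ofPred_eq, Set.mem_union, Set.mem_Ico, Set.mem_Ioc]
    rw [q₁, q₂]
    constructor
    · rintro ⟨⟨h0, h2⟩, h3, h4⟩
      rw [aux_le_sin _ _ (by linarith) ha11 h0 h2] at h3
      rw [aux_le_sin _ _ ha20 (by linarith) h0 h2] at h4
      by_cases h : w < Real.arcsin a₁
      · exact Or.inl ⟨h4.1, h⟩
      · right
        refine ⟨?_, h4.2⟩
        by_contra h'
        exact h3 ⟨not_lt.1 h, not_lt.1 h'⟩
    · intro h
      have h0 : 0 ≤ w := by rcases h with h | h <;> linarith [h.1]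
      have h2 : w < 2 * π := by rcases h with h | h <;> linarith [h.2]
      rw [aux_le_sin _ _ (by linarith) ha11 h0 h2, aux_le_sin _ _ ha20 (by linarith) h0 h2]
      refine ⟨⟨h0, h2⟩, ?_, ?_⟩
      · rintro ⟨h3, h4⟩
        rcases h with h | h <;> linarith [h.1, h.2]
      · rcases h with h | h <;> constructor <;> linarith [h.1, h.2]
  rw [hset, measure_union _ measurableSet_Ioc, Real.volume_Ico, Real.volume_Ioc,
    ← ENNReal.ofReal_add (by linarith) (by linarith)]
  · congr 1; ring
  · rw [Set.disjoint_left]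
    intro x hx hy
    linarith [hx.2, hy.1]
end
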